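/- arXiv:2003.10708 — 2 statements merged into one kernel-verified Lean document; each statement's English description precedes it below -/
import Mathlib

section
/- In the setting of the previous Lee-form computation (2-step nilpotent 𝔤 with coframe α₁,…,α_n of (𝔤^{1,0})*, structure constants c^i_{rs}, c^i_{r s̄}, positive (n−1,n−1)-form ω̃ with matrix Ã, and θ = Σ_{i=1}^n a_i(α_i + ᾱ_i) the unique real 1-form with dω̃ = θ ∧ ω̃), the 1-form θ is closed if and only if Σ_{i=k+1}^n a_i c^i_{rs} = 0 and Σ_{i=k+1}^n a_i (c^i_{r s̄} − conj(c^i_{s r̄})) = 0 for all 1 ≤ r, s ≤ k. -/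
open scoped BigOperators ComplexOrder

/-- The strictly increasing enumeration of `Fin N` avoiding the two indices `a < b`. -/
def skipTwo {N : ℕ} (a b : ℕ) (t : Fin (N - 2)) : Fin N :=
  ⟨if (t : ℕ) < a then (t : ℕ) else if (t : ℕ) + 1 < b then (t : ℕ) + 1 else (t : ℕ) + 2,
    by have := t.isLt; split_ifs <;> omega⟩

/-- The Chevalley–Eilenberg differential of a (raw) `p`-form on a Lie algebra. -/
noncomputable def ceD {g : Type} [LieRing g] [LieAlgebra ℝ g] {p : ℕ}
    (η : (Fin p → g) → ℂ) : (Fin (p + 1) → g) → ℂ :=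
  fun X => ∑ i : Fin (p + 1), ∑ j : Fin (p + 1),
    if hij : (i : ℕ) < (j : ℕ) then
      (-1 : ℂ) ^ ((i : ℕ) + (j : ℕ)) *
        η (fun t => if ht : (t : ℕ) = 0 then ⁅X i, X j⁆
            else X (skipTwo (N := p + 1) (i : ℕ) (j : ℕ)
              ⟨(t : ℕ) - 1, by have := t.isLt; omega⟩))
    else 0

/-- The wedge product of a (raw) `p`-form and a (raw) `q`-form. -/
noncomputable def wedge {g : Type} [LieRing g] [LieAlgebra ℝ g] {p q : ℕ}
    (α : (Fin p → g) → ℂ) (β : (Fin q → g) → ℂ) : (Fin (p + q) → g) → ℂ :=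
  fun X => ((p.factorial : ℂ) * (q.factorial : ℂ))⁻¹ *
    ∑ σ : Equiv.Perm (Fin (p + q)),
      ((Equiv.Perm.sign σ : ℤ) : ℂ) *
        α (fun i => X (σ (Fin.castAdd q i))) * β (fun i => X (σ (Fin.natAdd p i)))

/-- The `k`-th wedge power of a (raw) `2`-form. -/
noncomputable def wpow {g : Type} [LieRing g] [LieAlgebra ℝ g]
    (ω : (Fin 2 → g) → ℂ) (k : ℕ) : (Fin (2 * k) → g) → ℂ :=
  fun X => ((2 : ℂ) ^ k)⁻¹ *
    ∑ σ : Equiv.Perm (Fin (2 * k)),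
      ((Equiv.Perm.sign σ : ℤ) : ℂ) *
        ∏ t : Fin k, ω (fun s => X (σ ⟨2 * (t : ℕ) + (s : ℕ),
          by have := t.isLt; have := s.isLt; omega⟩))

/-- The action of (the linear extension of) `J` on (raw) `p`-forms:
`(Jη)(X₁, …, X_p) = (−1)^p η(JX₁, …, JX_p)`. -/
noncomputable def Jact {g : Type} [LieRing g] [LieAlgebra ℝ g] (J : g →ₗ[ℝ] g) {p : ℕ}
    (η : (Fin p → g) → ℂ) : (Fin p → g) → ℂ :=
  fun X => (-1 : ℂ) ^ p * η (fun i => J (X i))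

/-- The operator `dᶜ = −J⁻¹ d J` on (raw) `p`-forms, where `J⁻¹ = (−1)^p J` on `p`-forms. -/
noncomputable def dcD {g : Type} [LieRing g] [LieAlgebra ℝ g] (J : g →ₗ[ℝ] g) {p : ℕ}
    (η : (Fin p → g) → ℂ) : (Fin (p + 1) → g) → ℂ :=
  fun X => (-1 : ℂ) ^ p * Jact J (ceD (Jact J η)) X

/-- A linear functional viewed as a raw `1`-form. -/
def oneF {g : Type} [LieRing g] [LieAlgebra ℝ g] (f : g → ℂ) : (Fin 1 → g) → ℂ :=
  fun X => f (X 0)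

/-- Reindexing a raw `a`-form as a `b`-form along a proof `a = b`. -/
def reind {g : Type} [LieRing g] [LieAlgebra ℝ g] {a b : ℕ} (h : a = b)
    (η : (Fin a → g) → ℂ) : (Fin b → g) → ℂ :=
  fun X => η (fun i => X (Fin.cast h i))

/-- The wedge product of a family of `p` raw `1`-forms. -/
noncomputable def wedgeList {g : Type} [LieRing g] [LieAlgebra ℝ g] {p : ℕ}
    (f : Fin p → g → ℂ) : (Fin p → g) → ℂ :=
  fun X => ∑ σ : Equiv.Perm (Fin p), ((Equiv.Perm.sign σ : ℤ) : ℂ) * ∏ t, f t (X (σ t))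

/-- The full coframe `α₁, ᾱ₁, …, α_n, ᾱ_n` as a list of `2n` raw `1`-forms. -/
noncomputable def coframeList {g : Type} [LieRing g] [LieAlgebra ℝ g] (n : ℕ)
    (α : Fin n → (g →ₗ[ℝ] ℂ)) : Fin (2 * n) → g → ℂ :=
  fun t x =>
    if (t : ℕ) % 2 = 0 then α ⟨(t : ℕ) / 2, by have := t.isLt; omega⟩ x
    else (starRingEnd ℂ) (α ⟨(t : ℕ) / 2, by have := t.isLt; omega⟩ x)

/-- The `(n−1, n−1)`-form `m_{i j̄}`: the wedge `α₁ ∧ ᾱ₁ ∧ … ∧ α_n ∧ ᾱ_n` with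
`α_i` and `ᾱ_j` deleted. -/
noncomputable def mForm {g : Type} [LieRing g] [LieAlgebra ℝ g] (n : ℕ)
    (α : Fin n → (g →ₗ[ℝ] ℂ)) (i j : Fin n) : (Fin (2 * n - 2) → g) → ℂ :=
  fun X => wedgeList (fun t =>
    coframeList n α
      (if 2 * (i : ℕ) < 2 * (j : ℕ) + 1
        then skipTwo (N := 2 * n) (2 * (i : ℕ)) (2 * (j : ℕ) + 1) t
        else skipTwo (N := 2 * n) (2 * (j : ℕ) + 1) (2 * (i : ℕ)) t)) X

lemma ceD_oneF_apply {g : Type} [LieRing g] [LieAlgebra ℝ g] (f : g → ℂ) (v : Fin 2 → g) :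
    ceD (oneF f) v = -f ⁅v 0, v 1⁆ := by
  simp [ceD, oneF, Fin.sum_univ_two]

lemma wedge_oneF_apply {g : Type} [LieRing g] [LieAlgebra ℝ g] (f h : g → ℂ) (v : Fin 2 → g) :
    wedge (oneF f) (oneF h) v = f (v 0) * h (v 1) - f (v 1) * h (v 0) := by
  have huniv : (Finset.univ : Finset (Equiv.Perm (Fin (1 + 1)))) = {1, Equiv.swap 0 1} := by
    decide
  have hne : (1 : Equiv.Perm (Fin (1 + 1))) ≠ Equiv.swap 0 1 := by decide
  have h0 : Fin.castAdd 1 (0 : Fin 1) = (0 : Fin (1 + 1)) := rfl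
  have h1 : Fin.natAdd 1 (0 : Fin 1) = (1 : Fin (1 + 1)) := rfl
  unfold wedge
  rw [huniv, Finset.sum_pair hne]
  simp only [oneF, h0, h1, Equiv.swap_apply_left, Equiv.swap_apply_right, Equiv.Perm.coe_one,
    id_eq, Equiv.Perm.sign_one, Equiv.Perm.sign_swap (show (0 : Fin (1 + 1)) ≠ 1 by decide)]
  simp
  ring

/-- The `2`-form `½ Σ P_{rs} z_r ∧ z_s + Σ M_{rs} z_r ∧ z̄_s` on `ι → ℂ`. -/
noncomputable def coordTwoForm {ι : Type} [Fintype ι] (P M : ι → ι → ℂ) (x y : ι → ℂ) : ℂ :=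
  ∑ r, ∑ s, ((1 / 2) * P r s * (x r * y s - y r * x s)
    + M r s * (x r * (starRingEnd ℂ) (y s) - y r * (starRingEnd ℂ) (x s)))

lemma coordTwoForm_single {ι : Type} [Fintype ι] [DecidableEq ι] (P M : ι → ι → ℂ)
    (hP : ∀ r s, P r s = -P s r) (r s : ι) (u v : ℂ) :
    coordTwoForm P M (Pi.single r u) (Pi.single s v) =
      P r s * (u * v) + M r s * (u * (starRingEnd ℂ) v) - M s r * (v * (starRingEnd ℂ) u) := by
  have hconj : ∀ (p q : ι) (w : ℂ), (starRingEnd ℂ) (Pi.single (M := fun _ => ℂ) p w q)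
      = Pi.single (M := fun _ => ℂ) p ((starRingEnd ℂ) w) q := by
    intro p q w
    simp only [Pi.single_apply]
    split_ifs <;> simp
  have hsum : ∀ (N : ι → ι → ℂ) (p q : ι) (w z : ℂ),
      ∑ a, ∑ b, N a b * (Pi.single (M := fun _ => ℂ) p w a * Pi.single (M := fun _ => ℂ) q z b)
        = N p q * (w * z) := by
    intro N p q w z
    simp [Pi.single_apply]
  simp only [coordTwoForm, hconj, mul_sub, Finset.sum_add_distrib, Finset.sum_sub_distrib,
    hsum (fun a b => 1 / 2 * P a b), hsum M]
  rw [hP s r]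
  ring

/-- The real part of `½ Σ P_{rs} z_r ∧ z_s + Σ M_{rs} z_r ∧ z̄_s` vanishes exactly when `P = 0`
and `M` is Hermitian. -/
lemma coordTwoForm_add_conj_eq_zero_iff {ι : Type} [Fintype ι] (P M : ι → ι → ℂ)
    (hP : ∀ r s, P r s = -P s r) :
    (∀ x y, coordTwoForm P M x y + (starRingEnd ℂ) (coordTwoForm P M x y) = 0) ↔
      ∀ r s, P r s = 0 ∧ M r s - (starRingEnd ℂ) (M s r) = 0 := by
  classical
  constructor
  · intro h r s
    have key : ∀ u v : ℂ, _ := fun u v => h (Pi.single r u) (Pi.single s v)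
    simp only [coordTwoForm_single P M hP] at key
    have h1 := congrArg Complex.re (key 1 1)
    have h2 := congrArg Complex.re (key Complex.I Complex.I)
    have h3 := congrArg Complex.re (key Complex.I 1)
    have h4 := congrArg Complex.re (key 1 Complex.I)
    simp at h1 h2 h3 h4
    refine ⟨Complex.ext ?_ ?_, Complex.ext ?_ ?_⟩ <;> simp <;> linarith
  · intro h x y
    have hM : ∀ r s, (starRingEnd ℂ) (M r s) = M s r := fun r s =>
      (sub_eq_zero.mp (h s r).2).symm
    have hswap : (starRingEnd ℂ) (coordTwoForm P M x y) = ∑ r, ∑ s,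
        M r s * ((starRingEnd ℂ) (x s) * y r - (starRingEnd ℂ) (y s) * x r) := by
      rw [Finset.sum_comm]
      simp [coordTwoForm, fun r s => (h r s).1, hM]
    rw [hswap, coordTwoForm, ← Finset.sum_add_distrib]
    refine Finset.sum_eq_zero fun r _ => ?_
    rw [← Finset.sum_add_distrib]
    refine Finset.sum_eq_zero fun s _ => ?_
    rw [(h r s).1]
    ring

/-- **closedness of the Lee form.**
In the setting of the Lee-form computation on a `2`-step complex nilpotent Lie algebra
(coframe `α₁,…,α_n`, structure constants `cⁱ_{rs}`, `cⁱ_{r s̄}`, positive `(n−1,n−1)`-form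
`ω̃` with matrix `Ã`, and `θ = Σ aᵢ(αᵢ + ᾱᵢ)` the unique real `1`-form with `dω̃ = θ ∧ ω̃`),
the form `θ` is closed if and only if `Σ_{i>k} aᵢ cⁱ_{rs} = 0` and
`Σ_{i>k} aᵢ (cⁱ_{r s̄} − conj(cⁱ_{s r̄})) = 0` for all `1 ≤ r, s ≤ k`. -/
theorem statement7 (n k : ℕ) (hk1 : 1 ≤ k) (hkn : k < n)
    (g : Type) [LieRing g] [LieAlgebra ℝ g]
    (h2step : ∀ x y z : g, ⁅⁅x, y⁆, z⁆ = 0)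
    (J : g →ₗ[ℝ] g)
    (hJ2 : ∀ x, J (J x) = -x)
    (hJi : ∀ x y : g, J ⁅x, y⁆ - ⁅J x, y⁆ - ⁅x, J y⁆ - J ⁅J x, J y⁆ = 0)
    (α : Fin n → (g →ₗ[ℝ] ℂ))
    (hα10 : ∀ i x, α i (J x) = Complex.I * α i x)
    (hbasis : Function.Bijective (fun (x : g) (i : Fin n) => α i x))
    (chol cmix : Fin n → Fin n → Fin n → ℂ)
    (hanti : ∀ i r s, chol i r s = - chol i s r)
    (hd1 : ∀ i : Fin n, (i : ℕ) < k → ceD (oneF fun x => α i x) = 0)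
    (hd2 : ∀ i : Fin n, k ≤ (i : ℕ) → ceD (oneF fun x => α i x) =
      fun v => ∑ r : Fin n, ∑ s : Fin n,
        if (r : ℕ) < k ∧ (s : ℕ) < k then
          (1 / 2 : ℂ) * chol i r s * wedge (oneF fun x => α r x) (oneF fun x => α s x) v
          + cmix i r s *
              wedge (oneF fun x => α r x) (oneF fun x => (starRingEnd ℂ) (α s x)) v
        else 0)
    (a : Fin n → Fin n → ℂ)
    (Atilde : Matrix (Fin n) (Fin n) ℂ)
    (hAt : ∀ i j, Atilde i j = if (i : ℕ) ≤ (j : ℕ) then a i j else -(a i j))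
    (hposdef : Atilde.PosDef)
    (ωt : (Fin (2 * n - 2) → g) → ℂ)
    (hωt : ωt = fun X =>
      Complex.I ^ (n - 1) * ∑ i : Fin n, ∑ j : Fin n, a i j * mForm n α i j X)
    (avec : Fin n → ℝ)
    (hLee : ceD ωt = reind (by omega)
      (wedge (oneF fun x => ∑ i : Fin n, (avec i : ℂ) * (α i x + (starRingEnd ℂ) (α i x)))
        ωt)) :
    ceD (oneF fun x => ∑ i : Fin n, (avec i : ℂ) * (α i x + (starRingEnd ℂ) (α i x))) = 0 ↔
    (∀ r s : Fin n, (r : ℕ) < k → (s : ℕ) < k →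
      (∑ i : Fin n, if k ≤ (i : ℕ) then (avec i : ℂ) * chol i r s else 0) = 0 ∧
      (∑ i : Fin n, if k ≤ (i : ℕ) then
          (avec i : ℂ) * (cmix i r s - (starRingEnd ℂ) (cmix i s r)) else 0) = 0) := by
  set P : Fin n → Fin n → ℂ := fun r s => if (r : ℕ) < k ∧ (s : ℕ) < k then
    ∑ i : Fin n, if k ≤ (i : ℕ) then (avec i : ℂ) * chol i r s else 0 else 0 with hPdef
  set M : Fin n → Fin n → ℂ := fun r s => if (r : ℕ) < k ∧ (s : ℕ) < k then
    ∑ i : Fin n, if k ≤ (i : ℕ) then (avec i : ℂ) * cmix i r s else 0 else 0 with hMdef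
  have hPanti : ∀ r s, P r s = -P s r := by
    intro r s
    simp only [hPdef, and_comm (a := (r : ℕ) < k)]
    split_ifs
    · rw [← Finset.sum_neg_distrib]
      refine Finset.sum_congr rfl fun i _ => ?_
      rw [hanti i r s]
      split_ifs <;> simp
    · simp
  have hbracket : ∀ x y : g, -∑ i : Fin n, (avec i : ℂ) * α i ⁅x, y⁆ =
      coordTwoForm P M (fun i => α i x) (fun i => α i y) := by
    intro x y
    have hi : ∀ i : Fin n, -((avec i : ℂ) * α i ⁅x, y⁆) = ∑ r : Fin n, ∑ s : Fin n,
        if (r : ℕ) < k ∧ (s : ℕ) < k then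
          (1 / 2) * (if k ≤ (i : ℕ) then (avec i : ℂ) * chol i r s else 0)
              * (α r x * α s y - α r y * α s x)
            + (if k ≤ (i : ℕ) then (avec i : ℂ) * cmix i r s else 0)
              * (α r x * (starRingEnd ℂ) (α s y) - α r y * (starRingEnd ℂ) (α s x))
        else 0 := by
      intro i
      rcases lt_or_ge (i : ℕ) k with hik | hik
      · have h := congrFun (hd1 i hik) ![x, y]
        rw [ceD_oneF_apply] at h
        simp only [Matrix.cons_val_zero, Matrix.cons_val_one, Pi.zero_apply, neg_eq_zero] at h
        simp [h, not_le.mpr hik]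
      · have h := congrFun (hd2 i hik) ![x, y]
        simp only [wedge_oneF_apply, ceD_oneF_apply, Matrix.cons_val_zero,
          Matrix.cons_val_one] at h
        rw [← mul_neg, h, Finset.mul_sum]
        refine Finset.sum_congr rfl fun r _ => ?_
        rw [Finset.mul_sum]
        refine Finset.sum_congr rfl fun s _ => ?_
        simp only [if_pos hik]
        split_ifs <;> ring
    rw [← Finset.sum_neg_distrib, Finset.sum_congr rfl fun i _ => hi i, Finset.sum_comm,
      coordTwoForm]
    refine Finset.sum_congr rfl fun r _ => ?_
    rw [Finset.sum_comm]
    refine Finset.sum_congr rfl fun s _ => ?_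
    simp only [hPdef, hMdef]
    split_ifs
    · simp only [Finset.sum_add_distrib, Finset.mul_sum, Finset.sum_mul]
    · simp
  have hclosed : ceD (oneF fun x =>
      ∑ i : Fin n, (avec i : ℂ) * (α i x + (starRingEnd ℂ) (α i x))) = 0 ↔
      ∀ x y, coordTwoForm P M x y + (starRingEnd ℂ) (coordTwoForm P M x y) = 0 := by
    have hval : ∀ v : Fin 2 → g, ceD (oneF fun x =>
        ∑ i : Fin n, (avec i : ℂ) * (α i x + (starRingEnd ℂ) (α i x))) v =
        coordTwoForm P M (fun i => α i (v 0)) (fun i => α i (v 1)) +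
          (starRingEnd ℂ) (coordTwoForm P M (fun i => α i (v 0)) (fun i => α i (v 1))) := by
      intro v
      rw [ceD_oneF_apply, ← hbracket]
      simp only [mul_add, Finset.sum_add_distrib, map_neg, map_sum, map_mul, Complex.conj_ofReal]
      ring
    constructor
    · intro h x y
      obtain ⟨x, rfl⟩ := hbasis.2 x
      obtain ⟨y, rfl⟩ := hbasis.2 y
      exact (hval ![x, y]).symm.trans (congrFun h ![x, y])
    · intro h
      funext v
      exact (hval v).trans (h _ _)
  rw [hclosed, coordTwoForm_add_conj_eq_zero_iff P M hPanti]
  have hMherm : ∀ r s : Fin n, (r : ℕ) < k → (s : ℕ) < k →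
      M r s - (starRingEnd ℂ) (M s r) = ∑ i : Fin n, if k ≤ (i : ℕ) then
        (avec i : ℂ) * (cmix i r s - (starRingEnd ℂ) (cmix i s r)) else 0 := by
    intro r s hr hs
    simp only [hMdef, hr, hs, and_self, if_true, map_sum, ← Finset.sum_sub_distrib]
    refine Finset.sum_congr rfl fun i _ => ?_
    split_ifs
    · rw [map_mul, Complex.conj_ofReal, mul_sub]
    · simp
  refine forall₂_congr fun r s => ?_
  by_cases hrs : (r : ℕ) < k ∧ (s : ℕ) < k
  · rw [hMherm r s hrs.1 hrs.2]
    simp [hPdef, hrs.1, hrs.2]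
  · have hsr : ¬((s : ℕ) < k ∧ (r : ℕ) < k) := fun h => hrs h.symm
    have hP0 : P r s = 0 := if_neg hrs
    have hM0 : M r s = 0 := if_neg hrs
    have hM1 : M s r = 0 := if_neg hsr
    rw [hP0, hM0, hM1]
    simp only [map_zero, sub_self, and_self, true_iff]
    exact fun hr hs => absurd ⟨hr, hs⟩ hrs
end

section
/- Let 𝔤 be a nonabelian 2-step nilpotent real Lie algebra of dimension 2n (so [𝔤,𝔤] ≠ 0 and [[𝔤,𝔤],𝔤] = 0) with complex structure J such that the center 𝔠 of 𝔤 is J-invariant. Then there exist an integer 1 ≤ k ≤ n−1, a basis α₁,…,α_n of (𝔤^{1,0})*, and complex constants c^i_{rs}, c^i_{r s̄} (1 ≤ r, s ≤ k, k < i ≤ n) such that dα_i = 0 for 1 ≤ i ≤ k and dα_i = Σ_{r,s=1}^k ((1/2) c^i_{rs} α_r ∧ α_s + c^i_{r s̄} α_r ∧ ᾱ_s) for k < i ≤ n; moreover α_{k+1},…,α_n can be taken dual to a basis of (𝔠 ⊗ ℂ) ∩ 𝔤^{1,0}. -/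
open scoped BigOperators

/-- A basis adapted to a subspace: the subspace is cut out by the first coordinates. -/
theorem exists_basis_mem_iff_repr_eq_zero {K V : Type*} [Field K] [AddCommGroup V] [Module K V]
    [FiniteDimensional K V] (W : Submodule K V) {n : ℕ} (hn : Module.finrank K V = n) :
    ∃ b : Module.Basis (Fin n) K V, ∀ x : V,
      x ∈ W ↔ ∀ i : Fin n, (i : ℕ) < n - Module.finrank K W → b.repr x i = 0 := by
  obtain ⟨U, hU⟩ := W.exists_isCompl
  have hadd : Module.finrank K U + Module.finrank K W = n := by
    rw [add_comm, Submodule.finrank_add_eq_of_isCompl hU, hn]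
  let e := Submodule.prodEquivOfIsCompl U W hU.symm
  let b := (((Module.finBasis K U).prod (Module.finBasis K W)).map e).reindex
    (finSumFinEquiv.trans (finCongr hadd))
  have hk : n - Module.finrank K W = Module.finrank K U := by omega
  refine ⟨b, fun x => ?_⟩
  have hx : x ∈ W ↔ (e.symm x).1 = 0 :=
    (Submodule.prodEquivOfIsCompl_symm_apply_fst_eq_zero (h := hU.symm)).symm
  rw [hx, hk]
  have hrepr (j : Fin (Module.finrank K U)) :
      b.repr x (finCongr hadd (finSumFinEquiv (Sum.inl j))) =
        (Module.finBasis K U).repr (e.symm x).1 j := by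
    rw [Module.Basis.repr_reindex_apply]
    simp
  constructor
  · intro h i hi
    have := hrepr ⟨i, hi⟩
    rw [h] at this
    simpa using this
  · intro h
    apply (Module.finBasis K U).repr.map_eq_zero_iff.mp
    ext j
    rw [← hrepr]
    exact h _ (by simp)

/-- The complex vector space structure given by a real endomorphism of square `-1`. -/
noncomputable abbrev complexModuleOfSqEqNeg {V : Type*} [AddCommGroup V] [Module ℝ V]
    (J : V →ₗ[ℝ] V) (hJ : J * J = -1) : Module ℂ V :=
  Module.compHom V (Complex.lift ⟨J, hJ⟩ : ℂ →ₐ[ℝ] Module.End ℝ V).toRingHom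

theorem smul_eq_re_add_im {V : Type*} [AddCommGroup V] [Module ℝ V] [Module ℂ V]
    [IsScalarTower ℝ ℂ V] (z : ℂ) (x : V) :
    z • x = z.re • x + z.im • (Complex.I • x) := by
  conv_lhs => rw [← Complex.re_add_im z]
  have hreal (r : ℝ) (y : V) : (r : ℂ) • y = r • y := by
    rw [← algebraMap_smul ℂ r y, Complex.coe_algebraMap]
  rw [add_smul, mul_smul, hreal, hreal]

/-- A complex-valued alternating real bilinear form without `(0,2)` part, in coordinates. -/
theorem exists_coeff_of_no_zero_two_part {V : Type*} [AddCommGroup V] [Module ℝ V] [Module ℂ V]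
    [IsScalarTower ℝ ℂ V] {ι : Type*} [Fintype ι] (b : Module.Basis ι ℂ V)
    (B : V →ₗ[ℝ] V →ₗ[ℝ] ℂ) (hanti : ∀ x y, B x y = -B y x)
    (hint : ∀ x y, Complex.I * B x y - B (Complex.I • x) y - B x (Complex.I • y)
      - Complex.I * B (Complex.I • x) (Complex.I • y) = 0)
    (p : ι → Prop) [DecidablePred p]
    (hrad : ∀ r, ¬ p r → B (b r) = 0 ∧ B (Complex.I • b r) = 0) :
    ∃ c m : ι → ι → ℂ, ∀ x y, B x y = ∑ r, ∑ s, if p r ∧ p s then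
      (1 / 2 : ℂ) * c r s * (b.repr x r * b.repr y s - b.repr y r * b.repr x s)
        + m r s * (b.repr x r * starRingEnd ℂ (b.repr y s)
          - b.repr y r * starRingEnd ℂ (b.repr x s)) else 0 := by
  have hI : ∀ x : V, Complex.I • Complex.I • x = -x := fun x => by
    rw [← mul_smul, Complex.I_mul_I, neg_one_smul]
  have hsm (z : ℂ) : z = (z.re : ℂ) + z.im * Complex.I := (Complex.re_add_im z).symm
  have hsc (z : ℂ) : starRingEnd ℂ z = (z.re : ℂ) - z.im * Complex.I := by
    apply Complex.ext <;> simp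
  let P : V →ₗ[ℂ] V →ₗ[ℂ] ℂ := LinearMap.mk₂ ℂ
    (fun x y => (1 / 4 : ℂ) * (B x y - Complex.I * B (Complex.I • x) y
      - Complex.I * B x (Complex.I • y) - B (Complex.I • x) (Complex.I • y)))
    (fun x y z => by simp only [smul_add, map_add, LinearMap.add_apply]; ring)
    (fun z x y => by
      rw [smul_comm Complex.I z x, smul_eq_re_add_im z x, smul_eq_re_add_im z (Complex.I • x), hI]
      simp only [map_add, map_smul, map_neg, LinearMap.add_apply, LinearMap.smul_apply,
        LinearMap.neg_apply, Complex.real_smul, smul_eq_mul]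
      conv_rhs => rw [hsm z]
      linear_combination
        (1 / 4 : ℂ) * z.im * (B (Complex.I • x) y + B x (Complex.I • y)) * Complex.I_sq)
    (fun x y z => by simp only [smul_add, map_add]; ring)
    (fun z x y => by
      rw [smul_comm Complex.I z y, smul_eq_re_add_im z y, smul_eq_re_add_im z (Complex.I • y), hI]
      simp only [map_add, map_smul, map_neg, Complex.real_smul, smul_eq_mul]
      conv_rhs => rw [hsm z]
      linear_combination
        (1 / 4 : ℂ) * z.im * (B (Complex.I • x) y + B x (Complex.I • y)) * Complex.I_sq)
  let Q : V →ₗ[ℂ] V →ₛₗ[starRingEnd ℂ] ℂ := LinearMap.mk₂'ₛₗ (RingHom.id ℂ) (starRingEnd ℂ)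
    (fun x y => (1 / 4 : ℂ) * (B x y - Complex.I * B (Complex.I • x) y
      + Complex.I * B x (Complex.I • y) + B (Complex.I • x) (Complex.I • y)))
    (fun x y z => by simp only [smul_add, map_add, LinearMap.add_apply]; ring)
    (fun z x y => by
      rw [smul_comm Complex.I z x, smul_eq_re_add_im z x, smul_eq_re_add_im z (Complex.I • x), hI]
      simp only [map_add, map_smul, map_neg, LinearMap.add_apply, LinearMap.smul_apply,
        LinearMap.neg_apply, Complex.real_smul, smul_eq_mul, RingHom.id_apply]
      conv_rhs => rw [hsm z]
      linear_combination
        (1 / 4 : ℂ) * z.im * (B (Complex.I • x) y - B x (Complex.I • y)) * Complex.I_sq)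
    (fun x y z => by simp only [smul_add, map_add]; ring)
    (fun z x y => by
      rw [smul_comm Complex.I z y, smul_eq_re_add_im z y, smul_eq_re_add_im z (Complex.I • y), hI]
      simp only [map_add, map_smul, map_neg, Complex.real_smul, smul_eq_mul]
      rw [hsc z]
      linear_combination
        (1 / 4 : ℂ) * z.im * (B x (Complex.I • y) - B (Complex.I • x) y) * Complex.I_sq)
  have hB (x y : V) : B x y = (1 / 2 : ℂ) * (P x y - P y x) + (Q x y - Q y x) := by
    simp only [P, Q, LinearMap.mk₂_apply, LinearMap.mk₂'ₛₗ_apply]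
    rw [hanti y x, hanti y (Complex.I • x), hanti (Complex.I • y) x,
      hanti (Complex.I • y) (Complex.I • x)]
    linear_combination -(1 / 4 : ℂ) * Complex.I * hint x y
      + (1 / 4 : ℂ) * (B x y - B (Complex.I • x) (Complex.I • y)) * Complex.I_sq
  have hP (x y : V) : P x y = ∑ r, ∑ s, P (b r) (b s) * (b.repr x r * b.repr y s) := by
    conv_lhs => rw [← b.sum_repr x, ← b.sum_repr y]
    simp only [map_sum, LinearMap.sum_apply, map_smul, LinearMap.smul_apply, smul_eq_mul]
    simp only [Finset.mul_sum]
    rw [Finset.sum_comm]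
    exact Finset.sum_congr rfl fun r _ => Finset.sum_congr rfl fun s _ => by ring
  have hQ (x y : V) : Q x y =
      ∑ r, ∑ s, Q (b r) (b s) * (b.repr x r * starRingEnd ℂ (b.repr y s)) := by
    conv_lhs => rw [← b.sum_repr x, ← b.sum_repr y]
    simp only [map_sum, LinearMap.sum_apply, map_smul, LinearMap.map_smulₛₗ, LinearMap.smul_apply,
      smul_eq_mul]
    simp only [Finset.mul_sum]
    rw [Finset.sum_comm]
    exact Finset.sum_congr rfl fun r _ => Finset.sum_congr rfl fun s _ => by ring
  refine ⟨fun r s => P (b r) (b s), fun r s => Q (b r) (b s), fun x y => ?_⟩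
  rw [hB, hP x y, hP y x, hQ x y, hQ y x]
  simp only [← Finset.sum_sub_distrib, Finset.mul_sum, ← Finset.sum_add_distrib]
  refine Finset.sum_congr rfl fun r _ => Finset.sum_congr rfl fun s _ => ?_
  split_ifs with h
  · ring
  · have hzero : P (b r) (b s) = 0 ∧ Q (b r) (b s) = 0 := by
      simp only [P, Q, LinearMap.mk₂_apply, LinearMap.mk₂'ₛₗ_apply]
      rcases not_and_or.mp h with h | h
      · simp [hrad r h]
      · rw [hanti _ (b s), hanti _ (b s), hanti _ (Complex.I • b s),
          hanti _ (Complex.I • b s)]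
        simp [hrad s h]
    rw [hzero.1, hzero.2]
    ring

theorem ceD_oneF {g : Type} [LieRing g] [LieAlgebra ℝ g] (f : g → ℂ) :
    ceD (oneF f) = fun v => -f ⁅v 0, v 1⁆ := by
  funext v
  simp [ceD, oneF, Fin.sum_univ_two]

theorem wedge_oneF_oneF {g : Type} [LieRing g] [LieAlgebra ℝ g] (f h : g → ℂ)
    (v : Fin (1 + 1) → g) :
    wedge (oneF f) (oneF h) v = f (v 0) * h (v 1) - f (v 1) * h (v 0) := by
  have huniv : (Finset.univ : Finset (Equiv.Perm (Fin (1 + 1)))) = {1, Equiv.swap 0 1} := by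
    decide
  simp only [wedge, huniv]
  rw [Finset.sum_pair (by decide)]
  simp [oneF, sub_eq_add_neg]

/-- Let `𝔤` be a nonabelian `2`-step nilpotent real Lie algebra of dimension
`2n` with complex structure `J` whose center is `J`-invariant.  Then there are `1 ≤ k ≤ n−1`,
a basis `α₁,…,α_n` of `(𝔤^{1,0})*` and constants `cⁱ_{rs}, cⁱ_{r s̄}` with `dαᵢ = 0` for
`i ≤ k` and `dαᵢ = Σ_{r,s≤k} ((1/2) cⁱ_{rs} α_r ∧ α_s + cⁱ_{r s̄} α_r ∧ ᾱ_s)` for `i > k`;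
moreover `α_{k+1},…,α_n` are dual to the center (the center is the joint kernel of
`α₁,…,α_k`). -/
theorem statement10 (n : ℕ) (hn : 1 ≤ n)
    (g : Type) [LieRing g] [LieAlgebra ℝ g] [FiniteDimensional ℝ g]
    (hdim : Module.finrank ℝ g = 2 * n)
    (h2step : ∀ x y z : g, ⁅⁅x, y⁆, z⁆ = 0)
    (hnonab : ∃ x y : g, ⁅x, y⁆ ≠ 0)
    (J : g →ₗ[ℝ] g)
    (hJ2 : ∀ x, J (J x) = -x)
    (hJi : ∀ x y : g, J ⁅x, y⁆ - ⁅J x, y⁆ - ⁅x, J y⁆ - J ⁅J x, J y⁆ = 0)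
    (hcenter : ∀ x : g, x ∈ LieAlgebra.center ℝ g → J x ∈ LieAlgebra.center ℝ g) :
    ∃ k : ℕ, 1 ≤ k ∧ k ≤ n - 1 ∧
      ∃ α : Fin n → (g →ₗ[ℝ] ℂ),
        (∀ i x, α i (J x) = Complex.I * α i x) ∧
        Function.Bijective (fun (x : g) (i : Fin n) => α i x) ∧
        ∃ chol cmix : Fin n → Fin n → Fin n → ℂ,
          (∀ i : Fin n, (i : ℕ) < k → ceD (oneF fun x => α i x) = 0) ∧
          (∀ i : Fin n, k ≤ (i : ℕ) → ceD (oneF fun x => α i x) =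
            fun v => ∑ r : Fin n, ∑ s : Fin n,
              if (r : ℕ) < k ∧ (s : ℕ) < k then
                (1 / 2 : ℂ) * chol i r s *
                    wedge (oneF fun x => α r x) (oneF fun x => α s x) v
                + cmix i r s *
                    wedge (oneF fun x => α r x) (oneF fun x => (starRingEnd ℂ) (α s x)) v
              else 0) ∧
          (∀ x : g, x ∈ LieAlgebra.center ℝ g ↔
            ∀ i : Fin n, (i : ℕ) < k → α i x = 0) := by
  have hJJ : J * J = -1 := by ext x; simp [hJ2]
  let _ : Module ℂ g := complexModuleOfSqEqNeg J hJJ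
  have hsmul (z : ℂ) (x : g) : z • x = z.re • x + z.im • J x := by
    change (Complex.lift ⟨J, hJJ⟩ : ℂ →ₐ[ℝ] Module.End ℝ g) z x = _
    simp [Complex.liftAux_apply]
  have hI (x : g) : Complex.I • x = J x := by simp [hsmul]
  have : IsScalarTower ℝ ℂ g := ⟨fun r z x => by simp [hsmul, mul_smul]⟩
  have : FiniteDimensional ℂ g := FiniteDimensional.right ℝ ℂ g
  have hfin : Module.finrank ℂ g = n := by
    have := Module.finrank_mul_finrank ℝ ℂ g
    rw [Complex.finrank_real_complex] at this
    omega
  have hmem (x : g) : x ∈ LieAlgebra.center ℝ g ↔ ∀ y : g, ⁅y, x⁆ = 0 := Iff.rfl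
  let W : Submodule ℂ g :=
    { carrier := {x | x ∈ LieAlgebra.center ℝ g}
      add_mem' := fun hx hy => (LieAlgebra.center ℝ g).toSubmodule.add_mem hx hy
      zero_mem' := (LieAlgebra.center ℝ g).toSubmodule.zero_mem
      smul_mem' := fun z x hx => by
        rw [hsmul]
        exact (LieAlgebra.center ℝ g).toSubmodule.add_mem
          (Submodule.smul_mem _ _ hx) (Submodule.smul_mem _ _ (hcenter x hx)) }
  have hcomm (x y : g) : ⁅x, y⁆ ∈ LieAlgebra.center ℝ g := fun z => by
    rw [← lie_skew, h2step, neg_zero]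
  obtain ⟨x₀, y₀, hxy⟩ := hnonab
  have hWpos : 0 < Module.finrank ℂ W :=
    Module.finrank_pos_iff_exists_ne_zero.mpr
      ⟨⟨⁅x₀, y₀⁆, hcomm x₀ y₀⟩, fun h => hxy (congrArg Subtype.val h)⟩
  have hWlt : Module.finrank ℂ W < n := by
    rw [← hfin]
    refine Submodule.finrank_lt fun h => hxy ?_
    have hy : y₀ ∈ W := h ▸ Submodule.mem_top
    exact hy x₀
  obtain ⟨b, hb⟩ := exists_basis_mem_iff_repr_eq_zero W hfin
  let α (i : Fin n) : g →ₗ[ℝ] ℂ := (b.coord i).restrictScalars ℝ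
  have hα (i : Fin n) (x : g) : α i x = b.repr x i := rfl
  have hαJ (i : Fin n) (x : g) : α i (J x) = Complex.I * α i x := by
    rw [hα, hα, ← hI, map_smul, Finsupp.smul_apply, smul_eq_mul]
  let B (i : Fin n) : g →ₗ[ℝ] g →ₗ[ℝ] ℂ :=
    LinearMap.mk₂ ℝ (fun x y => -α i ⁅x, y⁆)
      (fun x y z => by simp only [add_lie, map_add, neg_add])
      (fun r x y => by simp only [smul_lie, map_smul, smul_neg])
      (fun x y z => by simp only [lie_add, map_add, neg_add])
      (fun r x y => by simp only [lie_smul, map_smul, smul_neg])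
  have hBα (i : Fin n) (x y : g) : B i x y = -α i ⁅x, y⁆ := rfl
  have hcoeff (i : Fin n) := exists_coeff_of_no_zero_two_part b (B i)
    (fun x y => by rw [hBα, hBα, ← lie_skew, map_neg])
    (fun x y => by
      have h := congrArg (α i) (hJi x y)
      simp only [map_sub, hαJ, map_zero] at h
      simp only [hI, hBα]
      linear_combination -h)
    (fun r => (r : ℕ) < n - Module.finrank ℂ W)
    (fun r hr => by
      have hbr : b r ∈ LieAlgebra.center ℝ g := (hb (b r)).mpr fun j hj => by
        rw [b.repr_self, Finsupp.single_eq_of_ne]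
        rintro rfl
        exact hr hj
      have hlie {z : g} (hz : z ∈ LieAlgebra.center ℝ g) : B i z = 0 := by
        ext y
        rw [hBα, ← lie_skew, hz y]
        simp
      exact ⟨hlie hbr, by rw [hI]; exact hlie (hcenter _ hbr)⟩)
  choose c m hcm using hcoeff
  refine ⟨n - Module.finrank ℂ W, by omega, by omega, α, hαJ, b.equivFun.bijective, c, m,
    fun i hi => ?_, fun i _ => ?_, hb⟩
  · rw [ceD_oneF]
    funext v
    simpa [hα] using (hb _).mp (hcomm (v 0) (v 1)) i hi
  · rw [ceD_oneF]
    funext v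
    simp only [wedge_oneF_oneF]
    exact hcm i (v 0) (v 1)
end
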